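/- The map Θ' : Ω → (A∖k)^ℤ is a homeomorphism, and it conjugates Φ with the left shift: Θ' ∘ Φ = σ ∘ Θ', where σ((c_n)_{n∈ℤ}) = (c_{n+1})_{n∈ℤ} is the left shift on bilateral sequences in (A∖k)^ℤ. -/

import Mathlib

open MeasureTheory
open scoped ENNReal Classical

noncomputable section

namespace ArtinCoding

variable (k : Type*) [Field k] [Fintype k]

/-- The field `K̂ = k((X⁻¹))` of formal Laurent series in `X⁻¹` over `k`, realized as the
field of formal Laurent series `k((t))` in the variable `t = X⁻¹`. -/
abbrev Khat := LaurentSeries k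

variable {k}

/-- The absolute value `|f|_∞ = q^{-v_∞(f)}`, where `v_∞` is the order of vanishing in the
variable `t = X⁻¹` (so a nonzero polynomial in `X` has absolute value `≥ 1`). -/
def absInf (f : Khat k) : ℝ :=
  if f = 0 then 0 else (Fintype.card k : ℝ) ^ (-f.order)

lemma absInf_nonneg (f : Khat k) : 0 ≤ absInf f := by
  unfold absInf
  split
  · exact le_refl 0
  · positivity

lemma absInf_eq_zero {f : Khat k} : absInf f = 0 ↔ f = 0 := by
  constructor
  · intro h
    by_contra hf
    have hq : (0:ℝ) < (Fintype.card k : ℝ) := by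
      have := Fintype.card_pos (α := k); positivity
    rw [absInf, if_neg hf] at h
    exact absurd h (ne_of_gt (zpow_pos hq _))
  · intro h; simp [absInf, h]

lemma absInf_neg (f : Khat k) : absInf (-f) = absInf f := by
  unfold absInf
  rw [neg_eq_zero, HahnSeries.order_neg]

lemma absInf_add_le (f g : Khat k) : absInf (f + g) ≤ max (absInf f) (absInf g) := by
  rcases eq_or_ne (f + g) 0 with h | h
  · rw [show absInf (f+g) = 0 by rw [absInf_eq_zero]; exact h]
    exact le_max_of_le_left (absInf_nonneg f)
  rcases eq_or_ne f 0 with hf | hf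
  · simp [hf]
  rcases eq_or_ne g 0 with hg | hg
  · simp [hg]
  have hmin := HahnSeries.min_order_le_order_add h
  have hq : (1:ℝ) ≤ (Fintype.card k : ℝ) := by
    exact_mod_cast Nat.one_le_iff_ne_zero.mpr Fintype.card_ne_zero
  rw [absInf, if_neg h]
  rcases le_total f.order g.order with hod | hod
  · rw [min_eq_left hod] at hmin
    refine le_max_of_le_left ?_
    rw [absInf, if_neg hf]
    exact zpow_le_zpow_right₀ hq (neg_le_neg hmin)
  · rw [min_eq_right hod] at hmin
    refine le_max_of_le_right ?_
    rw [absInf, if_neg hg]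
    exact zpow_le_zpow_right₀ hq (neg_le_neg hmin)

/-- The metric `d_∞(f,g) = |f-g|_∞` on `K̂`. -/
noncomputable instance : MetricSpace (Khat k) where
  dist f g := absInf (f - g)
  dist_self f := by simp [absInf]
  dist_comm f g := by
    have : g - f = -(f - g) := by ring
    show absInf (f - g) = absInf (g - f)
    rw [this, absInf_neg]
  dist_triangle f g h := by
    show absInf (f - h) ≤ absInf (f - g) + absInf (g - h)
    have key : absInf (f - h) ≤ max (absInf (f - g)) (absInf (g - h)) := by
      have : f - h = (f - g) + (g - h) := by ring
      rw [this]; exact absInf_add_le _ _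
    exact key.trans (max_le_add_of_nonneg (absInf_nonneg _) (absInf_nonneg _))
  eq_of_dist_eq_zero := by
    intro f g h
    have : f - g = 0 := absInf_eq_zero.mp h
    exact sub_eq_zero.mp this

/- Make sure the topology coming from the metric `d_∞` is the one used everywhere
(the valued-field uniformity on Laurent series induces the same topology). -/
instance (priority := 10000) : UniformSpace (Khat k) := PseudoMetricSpace.toUniformSpace
instance (priority := 10000) : TopologicalSpace (Khat k) := UniformSpace.toTopologicalSpace

instance : MeasurableSpace (Khat k) := borel _
instance : BorelSpace (Khat k) := ⟨rfl⟩

variable (k)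

/-- The element `X⁻¹` of `K̂` (the uniformizer `t`). -/
def Xinv : Khat k := HahnSeries.single (1 : ℤ) (1 : k)

/-- The element `X` of `K̂`. -/
def Xel : Khat k := HahnSeries.single (-1 : ℤ) (1 : k)

/-- The valuation ring `O = k[[X⁻¹]] = {f : |f|_∞ ≤ 1}`. -/
def Oball : Set (Khat k) := {f | absInf f ≤ 1}

/-- The set `X⁻¹O`, i.e. the maximal ideal of `O`. -/
def XinvO : Set (Khat k) := (fun f => Xinv k * f) '' Oball k

/-- The ring `A = k[X]` of polynomials in `X`, viewed as a subset of `K̂`. -/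
def Aset : Set (Khat k) := Set.range fun p : Polynomial k => Polynomial.aeval (Xel k) p

/-- The constants `k ⊆ K̂`. -/
def kconsts : Set (Khat k) := Set.range (algebraMap k (Khat k))

/-- The set `A∖k` of nonconstant polynomials in `X`, viewed inside `K̂`. -/
def AmK : Set (Khat k) := Aset k \ kconsts k

/-- The field `K = k(X)` of rational functions, viewed as a subset of `K̂`
(note that `k(X) = k(X⁻¹)` as a subfield of `K̂`). -/
def Kset : Set (Khat k) := Set.range fun r : RatFunc k => (r : LaurentSeries k)

/-- The set `ᶜK = K̂ ∖ K` of irrational elements. -/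
def cK : Set (Khat k) := (Kset k)ᶜ

variable {k}

/-- The integer part `[f] ∈ A = k[X]` of `f ∈ K̂`: the sum of the terms of `f` with
nonpositive exponents in `t = X⁻¹`. -/
def intPart (f : Khat k) : Khat k :=
  ∑ i ∈ Finset.Icc (min f.order 0) 0, HahnSeries.single i (f.coeff i)

/-- The fractional part `{f} = f - [f] ∈ X⁻¹O` of `f ∈ K̂`. -/
def fracPart (f : Khat k) : Khat k := f - intPart f

/-- The Artin map `Ψ(f) = 1/f - [1/f]`. -/
def ArtinPsi (f : Khat k) : Khat k := fracPart f⁻¹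

/-- The Artin continued fraction digit `a_{n+1}(f) = [1/Ψⁿ(f)]` (for `n : ℕ`, so that
`digit 0 f = a₁(f) = [1/f]`). -/
def digit (n : ℕ) (f : Khat k) : Khat k := intPart ((ArtinPsi (k := k))^[n] f)⁻¹

variable (k)

/-- The set `J = ⋃_{a ∈ A∖k} (a + X⁻¹O)`. -/
def Jset : Set (Khat k) := ⋃ a ∈ AmK k, (fun x => a + x) '' XinvO k

/-- The domain `Ω = (J ∩ ᶜK) × (X⁻¹O ∩ ᶜK)` of the natural extension of the Artin map. -/
def OmegaSet : Set (Khat k × Khat k) := (Jset k ∩ cK k) ×ˢ (XinvO k ∩ cK k)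

variable {k}

/-- The map `Φ(ξ₋, ξ₊) = (1/ξ₋ - [1/ξ₊], Ψ(ξ₊))` (as a globally defined map on `K̂ × K̂`). -/
def PhiRaw (p : Khat k × Khat k) : Khat k × Khat k :=
  (p.1⁻¹ - intPart p.2⁻¹, ArtinPsi p.2)

/-- The coding map `Θ'` sending `(ξ₋, ξ₊)` to the bilateral sequence `(c_n)_{n ∈ ℤ}` with
`c_n = a_n(ξ₊)` for `n ≥ 1` and `c_{-n} = a_{n+1}(-1/ξ₋)` for `n ≥ 0`. -/
def ThetaRaw (p : Khat k × Khat k) : ℤ → Khat k := fun n =>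
  if 1 ≤ n then digit (n - 1).toNat p.2 else digit (-n).toNat (-p.1⁻¹)

variable (k)

/-- The density `q²/|ξ₊ - ξ₋|²_∞`. -/
def dens (p : Khat k × Khat k) : ℝ≥0∞ :=
  ENNReal.ofReal ((Fintype.card k : ℝ) ^ 2 * ((absInf (p.2 - p.1)) ^ 2)⁻¹)

/-- The measure `m̂` on `Ω` given by `dm̂(ξ₋,ξ₊) = q² dμ(ξ₋) dμ(ξ₊)/|ξ₊ - ξ₋|²_∞`. -/
def mhat (μ : Measure (Khat k)) : Measure (Khat k × Khat k) :=
  (((μ.prod μ).withDensity (dens k))).restrict (OmegaSet k)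

/-- The weight `ν(a) = |a|_∞⁻² = q^{-2 deg a}` for `a ∈ A∖k` (and `0` otherwise),
with values in `ℝ≥0∞`. -/
def nuE (a : Khat k) : ℝ≥0∞ :=
  if a ∈ AmK k then ENNReal.ofReal (((absInf a) ^ 2)⁻¹) else 0

section Helpers

variable {k}

local notation "q" => (Fintype.card k : ℝ)

lemma one_lt_card_real : (1 : ℝ) < (Fintype.card k : ℝ) := by
  exact_mod_cast Fintype.one_lt_card

lemma card_real_pos : (0 : ℝ) < (Fintype.card k : ℝ) :=
  zero_lt_one.trans one_lt_card_real

lemma absInf_zero : absInf (0 : Khat k) = 0 := absInf_eq_zero.mpr rfl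

lemma absInf_pos {f : Khat k} (hf : f ≠ 0) : 0 < absInf f :=
  lt_of_le_of_ne (absInf_nonneg f) fun h => hf (absInf_eq_zero.mp h.symm)

lemma absInf_mul (f g : Khat k) : absInf (f * g) = absInf f * absInf g := by
  rcases eq_or_ne f 0 with rfl | hf
  · simp [absInf_zero]
  rcases eq_or_ne g 0 with rfl | hg
  · simp [absInf_zero]
  rw [absInf, absInf, absInf, if_neg hf, if_neg hg, if_neg (mul_ne_zero hf hg),
    HahnSeries.order_mul hf hg, neg_add, zpow_add₀ card_real_pos.ne']

lemma absInf_one : absInf (1 : Khat k) = 1 := by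
  simp [absInf]

lemma absInf_inv (f : Khat k) : absInf f⁻¹ = (absInf f)⁻¹ := by
  rcases eq_or_ne f 0 with rfl | hf
  · simp [absInf_zero]
  refine eq_inv_of_mul_eq_one_left ?_
  rw [← absInf_mul, inv_mul_cancel₀ hf, absInf_one]

lemma absInf_sub_comm (f g : Khat k) : absInf (f - g) = absInf (g - f) := by
  rw [← absInf_neg, neg_sub]

lemma absInf_sub_le (f g : Khat k) : absInf (f - g) ≤ max (absInf f) (absInf g) := by
  rw [sub_eq_add_neg, ← absInf_neg g]
  exact absInf_add_le _ _

lemma absInf_add_eq_left {f g : Khat k} (h : absInf g < absInf f) :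
    absInf (f + g) = absInf f := by
  refine le_antisymm ((absInf_add_le f g).trans_eq (max_eq_left h.le)) ?_
  have := absInf_sub_le (f + g) g
  rw [add_sub_cancel_right] at this
  exact (le_max_iff.mp this).resolve_right h.not_ge

lemma absInf_le_zpow_iff {f : Khat k} {n : ℤ} :
    absInf f ≤ q ^ (-n) ↔ ∀ i < n, f.coeff i = 0 := by
  rcases eq_or_ne f 0 with rfl | hf
  · simp [absInf_zero, zpow_nonneg card_real_pos.le]
  rw [absInf, if_neg hf, zpow_le_zpow_iff_right₀ one_lt_card_real, neg_le_neg_iff]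
  constructor
  · intro h i hi
    exact HahnSeries.coeff_eq_zero_of_lt_order (hi.trans_le h)
  · intro h
    by_contra! hlt
    exact hf (HahnSeries.coeff_order_eq_zero.mp (h _ hlt))

lemma absInf_lt_zpow_iff {f : Khat k} {n : ℤ} :
    absInf f < q ^ (-n) ↔ absInf f ≤ q ^ (-(n + 1)) := by
  rcases eq_or_ne f 0 with rfl | hf
  · simp [absInf_zero, zpow_nonneg card_real_pos.le, zpow_pos card_real_pos]
  rw [absInf, if_neg hf, zpow_le_zpow_iff_right₀ one_lt_card_real,
    zpow_lt_zpow_iff_right₀ one_lt_card_real]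
  lia

lemma absInf_lt_one_iff_coeff {f : Khat k} : absInf f < 1 ↔ ∀ i ≤ 0, f.coeff i = 0 := by
  have h := absInf_lt_zpow_iff (f := f) (n := 0)
  rw [neg_zero, zpow_zero] at h
  rw [h, absInf_le_zpow_iff]
  exact forall_congr' fun i => by rw [Int.lt_add_one_iff]

lemma absInf_le_inv_of_lt_one {f : Khat k} (hf : absInf f < 1) : absInf f ≤ q⁻¹ := by
  have h := absInf_lt_zpow_iff (f := f) (n := 0)
  simpa using h.mp (by simpa using hf)

lemma absInf_le_of_lt {f g : Khat k} (h : absInf f < absInf g) :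
    absInf f ≤ q⁻¹ * absInf g := by
  have hg : 0 < absInf g := (absInf_nonneg f).trans_lt h
  have : absInf (f / g) < 1 := by
    rw [div_eq_mul_inv, absInf_mul, absInf_inv, ← div_eq_mul_inv, div_lt_one hg]
    exact h
  have := absInf_le_inv_of_lt_one this
  rwa [div_eq_mul_inv, absInf_mul, absInf_inv, ← div_eq_mul_inv, div_le_iff₀ hg] at this

lemma dist_eq_absInf (f g : Khat k) : dist f g = absInf (f - g) := rfl

lemma absInf_Xinv : absInf (Xinv k) = q⁻¹ := by
  rw [absInf, if_neg (by simp [Xinv]), Xinv, HahnSeries.order_single one_ne_zero, zpow_neg_one]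

lemma Xinv_ne_zero : Xinv k ≠ 0 := by simp [Xinv]

lemma mem_XinvO {f : Khat k} : f ∈ XinvO k ↔ absInf f < 1 := by
  constructor
  · rintro ⟨g, hg, rfl⟩
    have hg : absInf g ≤ 1 := hg
    show absInf (Xinv k * g) < 1
    rw [absInf_mul, absInf_Xinv]
    have := inv_lt_one_of_one_lt₀ (one_lt_card_real (k := k))
    have := absInf_nonneg g
    have : 0 < q⁻¹ := inv_pos.mpr card_real_pos
    nlinarith
  · intro h
    refine ⟨(Xinv k)⁻¹ * f, ?_, mul_inv_cancel_left₀ Xinv_ne_zero f⟩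
    show absInf _ ≤ 1
    rw [absInf_mul, absInf_inv, absInf_Xinv, inv_inv]
    calc q * absInf f ≤ q * q⁻¹ :=
          mul_le_mul_of_nonneg_left (absInf_le_inv_of_lt_one h) card_real_pos.le
      _ = 1 := mul_inv_cancel₀ card_real_pos.ne'

lemma coeff_intPart (f : Khat k) (i : ℤ) :
    (intPart f).coeff i = if i ≤ 0 then f.coeff i else 0 := by
  have h : (intPart f).coeff i =
      ∑ j ∈ Finset.Icc (min f.order 0) 0, if i = j then f.coeff j else 0 := by
    rw [intPart, HahnSeries.coeff_sum]
    exact Finset.sum_congr rfl fun j _ => by rw [HahnSeries.coeff_single]; congr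
  rw [h, Finset.sum_ite_eq]
  by_cases hi : i ≤ 0
  · rw [if_pos hi]
    split_ifs with h'
    · rfl
    · rw [Finset.mem_Icc] at h'
      exact (HahnSeries.coeff_eq_zero_of_lt_order (by grind)).symm
  · rw [if_neg hi, if_neg (by simp; grind)]

lemma absInf_fracPart_lt_one (f : Khat k) : absInf (f - intPart f) < 1 := by
  rw [absInf_lt_one_iff_coeff]
  intro i hi
  simp [coeff_intPart, hi]

lemma intPart_eq_of_absInf_sub_lt {f g : Khat k} (h : absInf (f - g) < 1) :
    intPart f = intPart g := by
  rw [absInf_lt_one_iff_coeff] at h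
  ext i
  rw [coeff_intPart, coeff_intPart]
  split_ifs with hi
  · have := h i hi
    rwa [HahnSeries.coeff_sub, sub_eq_zero] at this
  · rfl

lemma single_neg_eq_aeval (n : ℕ) (c : k) :
    (HahnSeries.single (-(n : ℤ)) c : Khat k) =
      Polynomial.aeval (Xel k) (Polynomial.C c * Polynomial.X ^ n) := by
  simp [Xel, LaurentSeries.algebraMap_apply, HahnSeries.C_apply]

lemma coeff_eq_zero_of_mem_Aset {f : Khat k} (hf : f ∈ Aset k) {i : ℤ} (hi : 0 < i) :
    f.coeff i = 0 := by
  obtain ⟨p, rfl⟩ := hf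
  show (Polynomial.aeval (Xel k) p).coeff i = 0
  induction p using Polynomial.induction_on' with
  | add p r hp hr => rw [map_add, HahnSeries.coeff_add, hp, hr, add_zero]
  | monomial n c =>
    rw [← Polynomial.C_mul_X_pow_eq_monomial, ← single_neg_eq_aeval,
      HahnSeries.coeff_single_of_ne (by lia)]

lemma mem_Aset_iff {f : Khat k} :
    f ∈ Aset k ↔ f ∈ (Polynomial.aeval (R := k) (Xel k)).range := Iff.rfl

lemma intPart_mem_Aset (f : Khat k) : intPart f ∈ Aset k := by
  rw [mem_Aset_iff, intPart]
  refine Subalgebra.sum_mem _ fun i hi => ?_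
  have hi : i ≤ 0 := (Finset.mem_Icc.mp hi).2
  obtain ⟨n, rfl⟩ : ∃ n : ℕ, i = -(n : ℤ) := ⟨i.natAbs, by lia⟩
  exact ⟨_, (single_neg_eq_aeval n _).symm⟩

lemma intPart_of_mem_Aset {a : Khat k} (ha : a ∈ Aset k) : intPart a = a := by
  ext i
  rw [coeff_intPart]
  split_ifs with hi
  · rfl
  · exact (coeff_eq_zero_of_mem_Aset ha (not_le.mp hi)).symm

lemma eq_zero_of_mem_Aset_of_lt_one {a : Khat k} (ha : a ∈ Aset k) (h : absInf a < 1) :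
    a = 0 := by
  rw [absInf_lt_one_iff_coeff] at h
  ext i
  rcases le_or_gt i 0 with hi | hi
  · exact h i hi
  · exact coeff_eq_zero_of_mem_Aset ha hi

lemma mem_AmK_iff {a : Khat k} : a ∈ AmK k ↔ a ∈ Aset k ∧ 1 < absInf a := by
  refine and_congr_right fun ha => ?_
  rw [← not_le, not_iff_not]
  have h := absInf_le_zpow_iff (f := a) (n := 0)
  rw [neg_zero, zpow_zero] at h
  rw [h]
  constructor
  · rintro ⟨c, rfl⟩ i hi
    rw [LaurentSeries.algebraMap_apply, HahnSeries.C_apply, HahnSeries.coeff_single_of_ne hi.ne]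
  · intro h0
    refine ⟨a.coeff 0, ?_⟩
    rw [LaurentSeries.algebraMap_apply, HahnSeries.C_apply]
    ext i
    rcases lt_trichotomy i 0 with hi | rfl | hi
    · rw [HahnSeries.coeff_single_of_ne hi.ne, h0 i hi]
    · rw [HahnSeries.coeff_single_same]
    · rw [HahnSeries.coeff_single_of_ne hi.ne', coeff_eq_zero_of_mem_Aset ha hi]

lemma neg_mem_AmK {a : Khat k} (ha : a ∈ AmK k) : -a ∈ AmK k := by
  rw [mem_AmK_iff] at ha ⊢
  exact ⟨neg_mem (S := Subalgebra k (Khat k)) (mem_Aset_iff.mp ha.1), by rw [absInf_neg]; exact ha.2⟩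

lemma intPart_mem_AmK {f : Khat k} (hf : 1 < absInf f) : intPart f ∈ AmK k := by
  refine mem_AmK_iff.mpr ⟨intPart_mem_Aset f, ?_⟩
  have h := absInf_fracPart_lt_one f
  rw [absInf_sub_comm] at h
  have := absInf_add_eq_left (h.trans hf)
  rw [add_sub_cancel] at this
  rwa [this]

lemma mem_Jset_iff {f : Khat k} : f ∈ Jset k ↔ 1 < absInf f := by
  constructor
  · intro h
    obtain ⟨a, ha, x, hx, rfl⟩ : ∃ a ∈ AmK k, ∃ x ∈ XinvO k, a + x = f := by
      simpa only [Jset, Set.mem_iUnion, Set.mem_image, exists_prop] using h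
    rw [mem_AmK_iff] at ha
    rw [absInf_add_eq_left ((mem_XinvO.mp hx).trans ha.2)]
    exact ha.2
  · intro h
    refine Set.mem_biUnion (intPart_mem_AmK h) ⟨f - intPart f, ?_, add_sub_cancel _ _⟩
    exact mem_XinvO.mpr (absInf_fracPart_lt_one f)

open scoped RatFunc

lemma mem_Kset_iff {f : Khat k} :
    f ∈ Kset k ↔ f ∈ (algebraMap (RatFunc k) (LaurentSeries k)).fieldRange := Iff.rfl

lemma algebraMap_polynomial_eq_aeval (p : Polynomial k) :
    algebraMap (RatFunc k) (LaurentSeries k) (algebraMap (Polynomial k) (RatFunc k) p) =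
      Polynomial.aeval (Xinv k) p := by
  induction p using Polynomial.induction_on' with
  | add p r hp hr => simp only [map_add, hp, hr]
  | monomial n c =>
    rw [← Polynomial.C_mul_X_pow_eq_monomial]
    simp only [map_mul, map_pow, RatFunc.algebraMap_X, RatFunc.algebraMap_C, RatFunc.coe_X,
      Polynomial.aeval_C, Polynomial.aeval_X, Xinv]
    congr 1
    rw [← RatFunc.algebraMap_C, ← IsScalarTower.algebraMap_apply (Polynomial k) (RatFunc k)]
    simp [LaurentSeries.algebraMap_apply, HahnSeries.C_apply]

lemma Xinv_mul_Xel : Xinv k * Xel k = 1 := by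
  simp [Xinv, Xel]

lemma Xel_inv : (Xel k)⁻¹ = Xinv k := (eq_inv_of_mul_eq_one_left Xinv_mul_Xel).symm

lemma Aset_subset_Kset : Aset k ⊆ Kset k := by
  rintro _ ⟨p, rfl⟩
  rw [mem_Kset_iff]
  have hX : Xel k ∈ (algebraMap (RatFunc k) (LaurentSeries k)).fieldRange := by
    rw [← inv_inv (Xel k), Xel_inv]
    exact inv_mem ⟨RatFunc.X, RatFunc.coe_X⟩
  show Polynomial.aeval (Xel k) p ∈ _
  induction p using Polynomial.induction_on' with
  | add p r hp hr => rw [map_add]; exact add_mem hp hr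
  | monomial n c =>
    rw [← Polynomial.C_mul_X_pow_eq_monomial, map_mul, map_pow, Polynomial.aeval_X,
      Polynomial.aeval_C]
    refine mul_mem ?_ (pow_mem hX n)
    refine ⟨algebraMap (Polynomial k) (RatFunc k) (Polynomial.C c), ?_⟩
    rw [algebraMap_polynomial_eq_aeval, Polynomial.aeval_C]

lemma exists_Aset_mul_pow (p : Polynomial k) :
    ∃ b ∈ Aset k, Polynomial.aeval (Xinv k) p = b * Xinv k ^ p.natDegree := by
  let : Invertible (Xinv k) := ⟨Xel k, by rw [mul_comm, Xinv_mul_Xel], Xinv_mul_Xel⟩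
  exact ⟨_, ⟨p.reverse, rfl⟩, (Polynomial.eval₂_reverse_mul_pow (algebraMap k (Khat k))
    (Xinv k) p).symm⟩

lemma exists_Aset_div {f : Khat k} (hf : f ∈ Kset k) :
    ∃ b ∈ Aset k, ∃ s ∈ Aset k, s ≠ 0 ∧ f = b / s := by
  obtain ⟨r, rfl⟩ := hf
  obtain ⟨p, s, hs, rfl⟩ := IsFractionRing.div_surjective (A := Polynomial k) r
  have hs0 := nonZeroDivisors.ne_zero hs
  show ∃ b ∈ Aset k, ∃ t ∈ Aset k, t ≠ 0 ∧ algebraMap (RatFunc k) (LaurentSeries k) _ = b / t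
  have hne : algebraMap (RatFunc k) (LaurentSeries k) (algebraMap (Polynomial k) (RatFunc k) s)
      ≠ 0 := by
    simpa using hs0
  rw [map_div₀]
  rw [algebraMap_polynomial_eq_aeval] at hne ⊢
  rw [algebraMap_polynomial_eq_aeval]
  obtain ⟨b, hb, hb'⟩ := exists_Aset_mul_pow p
  obtain ⟨t, ht, ht'⟩ := exists_Aset_mul_pow s
  have hXA : Xel k ∈ (Polynomial.aeval (R := k) (Xel k)).range :=
    ⟨Polynomial.X, Polynomial.aeval_X _⟩
  have hX0 : Xel k ≠ 0 := right_ne_zero_of_mul (Xinv_mul_Xel (k := k) ▸ one_ne_zero)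
  refine ⟨b * Xel k ^ s.natDegree, mul_mem (mem_Aset_iff.mp hb) (pow_mem hXA _),
    t * Xel k ^ p.natDegree, mul_mem (mem_Aset_iff.mp ht) (pow_mem hXA _), ?_, ?_⟩
  · refine mul_ne_zero ?_ (pow_ne_zero _ hX0)
    rintro rfl
    exact hne (by rw [ht', zero_mul])
  · have ht0 : t ≠ 0 := by
      rintro rfl
      exact hne (by rw [ht', zero_mul])
    have hp : Xinv k ^ p.natDegree * Xel k ^ p.natDegree = 1 := by
      rw [← mul_pow, Xinv_mul_Xel, one_pow]
    have hs : Xinv k ^ s.natDegree * Xel k ^ s.natDegree = 1 := by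
      rw [← mul_pow, Xinv_mul_Xel, one_pow]
    rw [hb', ht', div_eq_div_iff (mul_ne_zero ht0 (pow_ne_zero _ Xinv_ne_zero))
      (mul_ne_zero ht0 (pow_ne_zero _ hX0))]
    linear_combination b * t * hp - b * t * hs

lemma mem_cK_iff {f : Khat k} :
    f ∈ cK k ↔ f ∉ (algebraMap (RatFunc k) (LaurentSeries k)).fieldRange := Iff.rfl

lemma inv_mem_cK {f : Khat k} (hf : f ∈ cK k) : f⁻¹ ∈ cK k := by
  rw [mem_cK_iff] at *
  rwa [inv_mem_iff]

lemma neg_mem_cK {f : Khat k} (hf : f ∈ cK k) : -f ∈ cK k := by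
  rw [mem_cK_iff] at *
  rwa [neg_mem_iff]

lemma sub_mem_cK {f a : Khat k} (hf : f ∈ cK k) (ha : a ∈ Aset k) : f - a ∈ cK k := by
  rw [mem_cK_iff] at *
  exact fun h => hf (by simpa using add_mem h (mem_Kset_iff.mp (Aset_subset_Kset ha)))

lemma ne_zero_of_mem_cK {f : Khat k} (hf : f ∈ cK k) : f ≠ 0 := by
  rintro rfl
  exact mem_cK_iff.mp hf (zero_mem _)

lemma one_lt_absInf_inv {f : Khat k} (hf : f ∈ XinvO k ∩ cK k) : 1 < absInf f⁻¹ := by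
  rw [absInf_inv, one_lt_inv₀ (absInf_pos (ne_zero_of_mem_cK hf.2))]
  exact mem_XinvO.mp hf.1

lemma ArtinPsi_mem {f : Khat k} (hf : f ∈ XinvO k ∩ cK k) : ArtinPsi f ∈ XinvO k ∩ cK k :=
  ⟨mem_XinvO.mpr (absInf_fracPart_lt_one _), sub_mem_cK (inv_mem_cK hf.2) (intPart_mem_Aset _)⟩

lemma digit_zero (f : Khat k) : digit 0 f = intPart f⁻¹ := rfl

lemma digit_succ (n : ℕ) (f : Khat k) : digit (n + 1) f = digit n (ArtinPsi f) := by
  rw [digit, digit, Function.iterate_succ_apply]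

lemma digit_mem_AmK {f : Khat k} (hf : f ∈ XinvO k ∩ cK k) (n : ℕ) : digit n f ∈ AmK k := by
  induction n generalizing f with
  | zero => exact intPart_mem_AmK (one_lt_absInf_inv hf)
  | succ n ih => rw [digit_succ]; exact ih (ArtinPsi_mem hf)

lemma digit_zero_add_ArtinPsi (f : Khat k) : digit 0 f + ArtinPsi f = f⁻¹ :=
  add_sub_cancel _ _

lemma intPart_add_of_lt_one {a x : Khat k} (ha : a ∈ Aset k) (hx : absInf x < 1) :
    intPart (a + x) = a := by
  rw [intPart_eq_of_absInf_sub_lt (g := a) (by rwa [add_sub_cancel_left]), intPart_of_mem_Aset ha]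

lemma digit_zero_inv_add {a x : Khat k} (ha : a ∈ Aset k) (hx : absInf x < 1) :
    digit 0 (a + x)⁻¹ = a := by
  rw [digit_zero, inv_inv, intPart_add_of_lt_one ha hx]

lemma ArtinPsi_inv_add {a x : Khat k} (ha : a ∈ Aset k) (hx : absInf x < 1) :
    ArtinPsi (a + x)⁻¹ = x := by
  rw [ArtinPsi, fracPart, inv_inv, intPart_add_of_lt_one ha hx, add_sub_cancel_left]

lemma absInf_add_of_mem_AmK {a x : Khat k} (ha : a ∈ AmK k) (hx : absInf x < 1) :
    absInf (a + x) = absInf a :=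
  absInf_add_eq_left (hx.trans (mem_AmK_iff.mp ha).2)

lemma absInf_inv_add_lt_one {a x : Khat k} (ha : a ∈ AmK k) (hx : absInf x < 1) :
    absInf (a + x)⁻¹ < 1 := by
  rw [absInf_inv, absInf_add_of_mem_AmK ha hx]
  exact inv_lt_one_of_one_lt₀ (mem_AmK_iff.mp ha).2

lemma absInf_inv_sub_inv {x y : Khat k} (hx : x ≠ 0) (hy : y ≠ 0) :
    absInf (x⁻¹ - y⁻¹) = absInf x⁻¹ * absInf (x - y) * absInf y⁻¹ := by
  rw [← absInf_mul, ← absInf_mul, ← absInf_neg]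
  congr 1
  field_simp
  ring

lemma add_ne_zero_of_mem_AmK {a x : Khat k} (ha : a ∈ AmK k) (hx : absInf x < 1) :
    a + x ≠ 0 := by
  intro h
  have h1 := absInf_add_of_mem_AmK ha hx
  rw [h, absInf_zero] at h1
  linarith [(mem_AmK_iff.mp ha).2]

lemma absInf_inv_add_sub_inv_add_le {a x y : Khat k} (ha : a ∈ AmK k) (hx : absInf x < 1)
    (hy : absInf y < 1) :
    absInf ((a + x)⁻¹ - (a + y)⁻¹) ≤ q⁻¹ * absInf (x - y) := by
  rw [absInf_inv_sub_inv (add_ne_zero_of_mem_AmK ha hx) (add_ne_zero_of_mem_AmK ha hy),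
    add_sub_add_left_eq_sub]
  have h1 := absInf_le_inv_of_lt_one (absInf_inv_add_lt_one ha hx)
  have h2 := (absInf_inv_add_lt_one ha hy).le
  calc _ ≤ q⁻¹ * absInf (x - y) * 1 :=
        mul_le_mul (mul_le_mul_of_nonneg_right h1 (absInf_nonneg _)) h2 (absInf_nonneg _)
          (mul_nonneg (inv_nonneg.mpr card_real_pos.le) (absInf_nonneg _))
    _ = _ := mul_one _

lemma inv_mul_zpow_neg (n : ℕ) : q⁻¹ * q ^ (-(n : ℤ)) = q ^ (-((n + 1 : ℕ) : ℤ)) := by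
  rw [← zpow_neg_one, ← zpow_add₀ card_real_pos.ne']
  congr 1
  push_cast
  ring

lemma absInf_inv_add_sub_inv_add_le_zpow {a x y : Khat k} (ha : a ∈ AmK k) (hx : absInf x < 1)
    (hy : absInf y < 1) {n : ℕ} (h : absInf (x - y) ≤ q ^ (-(n : ℤ))) :
    absInf ((a + x)⁻¹ - (a + y)⁻¹) ≤ q ^ (-((n + 1 : ℕ) : ℤ)) := by
  rw [← inv_mul_zpow_neg]
  exact (absInf_inv_add_sub_inv_add_le ha hx hy).trans
    (mul_le_mul_of_nonneg_left h (inv_nonneg.mpr card_real_pos.le))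

lemma absInf_sub_lt_one {f g : Khat k} (hf : absInf f < 1) (hg : absInf g < 1) :
    absInf (f - g) < 1 :=
  (absInf_sub_le f g).trans_lt (max_lt hf hg)

lemma absInf_sub_le_zpow {f g h : Khat k} {r : ℝ} (h1 : absInf (f - g) ≤ r)
    (h2 : absInf (g - h) ≤ r) : absInf (f - h) ≤ r := by
  rw [← sub_add_sub_cancel f g h]
  exact (absInf_add_le _ _).trans (max_le h1 h2)

lemma eq_of_forall_absInf_sub_le {f g : Khat k}
    (h : ∀ n : ℕ, absInf (f - g) ≤ q ^ (-(n : ℤ))) : f = g := by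
  ext i
  have := absInf_le_zpow_iff.mp (h (i.toNat + 1)) i (by lia)
  rwa [HahnSeries.coeff_sub, sub_eq_zero] at this

/-- The `n`-th convergent of the continued fraction with digits `a 0, a 1, …`. -/
def convergent : ℕ → (ℕ → Khat k) → Khat k
  | 0, _ => 0
  | n + 1, a => (a 0 + convergent n fun i => a (i + 1))⁻¹

lemma absInf_convergent_lt_one {a : ℕ → Khat k} (ha : ∀ n, a n ∈ AmK k) (n : ℕ) :
    absInf (convergent n a) < 1 := by
  induction n generalizing a with
  | zero => simp [convergent, absInf_zero]
  | succ n ih => exact absInf_inv_add_lt_one (ha 0) (ih fun i => ha (i + 1))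

lemma absInf_convergent_succ_sub_le {a : ℕ → Khat k} (ha : ∀ n, a n ∈ AmK k) (n : ℕ) :
    absInf (convergent (n + 1) a - convergent n a) ≤ q ^ (-(n : ℤ)) := by
  induction n generalizing a with
  | zero =>
    simpa using (absInf_sub_lt_one (absInf_convergent_lt_one ha 1)
      (absInf_convergent_lt_one ha 0)).le
  | succ n ih =>
    exact absInf_inv_add_sub_inv_add_le_zpow (ha 0)
      (absInf_convergent_lt_one (fun i => ha (i + 1)) _)
      (absInf_convergent_lt_one (fun i => ha (i + 1)) _) (ih fun i => ha (i + 1))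

lemma coeff_convergent_eq {a : ℕ → Khat k} (ha : ∀ n, a n ∈ AmK k) {n m : ℕ} (hnm : n ≤ m)
    {i : ℤ} (hi : i < n) : (convergent m a).coeff i = (convergent n a).coeff i := by
  induction m, hnm using Nat.le_induction with
  | base => rfl
  | succ m hm ih =>
    have := absInf_le_zpow_iff.mp (absInf_convergent_succ_sub_le ha m) i (by lia)
    rw [HahnSeries.coeff_sub, sub_eq_zero] at this
    rw [this, ih]

/-- The value of the infinite continued fraction with digits `a 0, a 1, …`. -/
def cfLimit (a : ℕ → Khat k) : Khat k :=
  HahnSeries.ofPowerSeries ℤ k (PowerSeries.mk fun i => (convergent (i + 1) a).coeff i)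

lemma absInf_cfLimit_sub_convergent_le {a : ℕ → Khat k} (ha : ∀ n, a n ∈ AmK k) (n : ℕ) :
    absInf (cfLimit a - convergent n a) ≤ q ^ (-(n : ℤ)) := by
  rw [absInf_le_zpow_iff]
  intro i hi
  rw [HahnSeries.coeff_sub, sub_eq_zero, cfLimit]
  rcases lt_or_ge i 0 with h0 | h0
  · rw [absInf_lt_one_iff_coeff.mp (absInf_convergent_lt_one ha n) i h0.le,
      PowerSeries.coeff_coe, if_pos h0]
  · lift i to ℕ using h0
    rw [HahnSeries.ofPowerSeries_apply_coeff, PowerSeries.coeff_mk]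
    exact (coeff_convergent_eq ha (by lia) (by lia)).symm

lemma absInf_cfLimit_lt_one {a : ℕ → Khat k} (ha : ∀ n, a n ∈ AmK k) :
    absInf (cfLimit a) < 1 := by
  have h1 : absInf (cfLimit a - convergent 1 a) < 1 := by
    refine (absInf_cfLimit_sub_convergent_le ha 1).trans_lt ?_
    simpa using inv_lt_one_of_one_lt₀ (one_lt_card_real (k := k))
  rw [← sub_add_cancel (cfLimit a) (convergent 1 a)]
  exact (absInf_add_le _ _).trans_lt (max_lt h1 (absInf_convergent_lt_one ha 1))

lemma cfLimit_eq {a : ℕ → Khat k} (ha : ∀ n, a n ∈ AmK k) :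
    cfLimit a = (a 0 + cfLimit fun i => a (i + 1))⁻¹ := by
  have ha' : ∀ n, a (n + 1) ∈ AmK k := fun n => ha (n + 1)
  refine eq_of_forall_absInf_sub_le fun n => ?_
  refine absInf_sub_le_zpow (g := convergent (n + 1) a) ?_ ?_
  · refine (absInf_cfLimit_sub_convergent_le ha (n + 1)).trans
      (zpow_le_zpow_right₀ one_lt_card_real.le (by lia))
  · refine (absInf_inv_add_sub_inv_add_le_zpow (ha 0) (absInf_convergent_lt_one ha' n)
      (absInf_cfLimit_lt_one ha') (n := n) ?_).trans
        (zpow_le_zpow_right₀ one_lt_card_real.le (by lia))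
    rw [absInf_sub_comm]
    exact absInf_cfLimit_sub_convergent_le ha' n

lemma cfLimit_ne_div {N : ℕ} {a : ℕ → Khat k} (ha : ∀ n, a n ∈ AmK k) {b s : Khat k}
    (hb : b ∈ Aset k) (hs : s ∈ Aset k) (hs0 : s ≠ 0) (hN : absInf s < q ^ N) :
    cfLimit a ≠ b / s := by
  induction N generalizing a b s with
  | zero =>
    rw [pow_zero] at hN
    exact absurd (eq_zero_of_mem_Aset_of_lt_one hs hN) hs0
  | succ N ih =>
    intro h
    have ha' : ∀ n, a (n + 1) ∈ AmK k := fun n => ha (n + 1)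
    have hlt := absInf_cfLimit_lt_one ha
    have hne : cfLimit a ≠ 0 := by
      rw [cfLimit_eq ha]
      exact inv_ne_zero (add_ne_zero_of_mem_AmK (ha 0) (absInf_cfLimit_lt_one ha'))
    have hb0 : b ≠ 0 := by
      rintro rfl
      exact hne (by rw [h, zero_div])
    rw [h, div_eq_mul_inv, absInf_mul, absInf_inv, ← div_eq_mul_inv,
      div_lt_one (absInf_pos hs0)] at hlt
    have hbN : absInf b < q ^ N := by
      refine (absInf_le_of_lt hlt).trans_lt ?_
      rw [inv_mul_lt_iff₀ card_real_pos, ← pow_succ']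
      exact hN
    refine ih ha' (b := s - a 0 * b) ?_ hb hb0 hbN ?_
    · exact sub_mem (S := Subalgebra k (Khat k)) (mem_Aset_iff.mp hs)
        (mul_mem (mem_Aset_iff.mp (mem_AmK_iff.mp (ha 0)).1) (mem_Aset_iff.mp hb))
    · have h2 := cfLimit_eq ha
      rw [h, eq_comm, inv_eq_iff_eq_inv, inv_div] at h2
      rw [eq_sub_of_add_eq' h2]
      field_simp

lemma cfLimit_mem {a : ℕ → Khat k} (ha : ∀ n, a n ∈ AmK k) :
    cfLimit a ∈ XinvO k ∩ cK k := by
  refine ⟨mem_XinvO.mpr (absInf_cfLimit_lt_one ha), fun h => ?_⟩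
  obtain ⟨b, hb, s, hs, hs0, h⟩ := exists_Aset_div h
  obtain ⟨N, hN⟩ := pow_unbounded_of_one_lt (absInf s) (one_lt_card_real (k := k))
  exact cfLimit_ne_div ha hb hs hs0 hN h

lemma digit_cfLimit {a : ℕ → Khat k} (ha : ∀ n, a n ∈ AmK k) (n : ℕ) :
    digit n (cfLimit a) = a n := by
  induction n generalizing a with
  | zero =>
    rw [cfLimit_eq ha, digit_zero_inv_add (mem_AmK_iff.mp (ha 0)).1
      (absInf_cfLimit_lt_one fun n => ha (n + 1))]
  | succ n ih =>
    rw [digit_succ, cfLimit_eq ha, ArtinPsi_inv_add (mem_AmK_iff.mp (ha 0)).1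
      (absInf_cfLimit_lt_one fun n => ha (n + 1)), ih fun n => ha (n + 1)]

lemma absInf_sub_le_of_digit_eq {f g : Khat k} (hf : f ∈ XinvO k ∩ cK k)
    (hg : g ∈ XinvO k ∩ cK k) {n : ℕ} (h : ∀ i < n, digit i f = digit i g) :
    absInf (f - g) ≤ q ^ (-(n : ℤ)) := by
  induction n generalizing f g with
  | zero => simpa using (absInf_sub_lt_one (mem_XinvO.mp hf.1) (mem_XinvO.mp hg.1)).le
  | succ n ih =>
    have hψ := ih (ArtinPsi_mem hf) (ArtinPsi_mem hg) fun i hi => by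
      rw [← digit_succ, ← digit_succ]
      exact h (i + 1) (by lia)
    have := absInf_inv_add_sub_inv_add_le_zpow (digit_mem_AmK hf 0)
      (mem_XinvO.mp (ArtinPsi_mem hf).1) (mem_XinvO.mp (ArtinPsi_mem hg).1) hψ
    nth_rewrite 2 [h 0 (by lia)] at this
    rwa [digit_zero_add_ArtinPsi, digit_zero_add_ArtinPsi, inv_inv, inv_inv] at this

lemma cfLimit_digit {f : Khat k} (hf : f ∈ XinvO k ∩ cK k) :
    (cfLimit fun n => digit n f) = f :=
  eq_of_forall_absInf_sub_le fun _ =>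
    absInf_sub_le_of_digit_eq (cfLimit_mem (digit_mem_AmK hf)) hf fun i _ =>
      digit_cfLimit (digit_mem_AmK hf) i

lemma absInf_inv_sub_inv_lt {x y : Khat k} (hx : x ≠ 0) {ε : ℝ} (h : absInf (y - x) < absInf x)
    (hε : absInf (y - x) < ε * absInf x ^ 2) : absInf (y⁻¹ - x⁻¹) < ε := by
  have hxpos := absInf_pos hx
  have hyx : absInf y = absInf x := by
    have := absInf_add_eq_left h
    rwa [add_sub_cancel] at this
  have hy : y ≠ 0 := by
    rintro rfl
    rw [absInf_zero] at hyx
    exact hxpos.ne hyx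
  rw [absInf_inv_sub_inv hy hx, absInf_inv, absInf_inv, hyx]
  calc _ = absInf (y - x) / absInf x ^ 2 := by field_simp
    _ < ε := by rwa [div_lt_iff₀ (by positivity)]

lemma continuousAt_inv_Khat {x : Khat k} (hx : x ≠ 0) :
    ContinuousAt (fun y : Khat k => y⁻¹) x := by
  rw [Metric.continuousAt_iff]
  intro ε hε
  have hxpos := absInf_pos hx
  exact ⟨min (absInf x) (ε * absInf x ^ 2), by positivity, fun {y} hy =>
    absInf_inv_sub_inv_lt hx (hy.trans_le (min_le_left _ _)) (hy.trans_le (min_le_right _ _))⟩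

lemma continuous_neg_Khat : Continuous fun y : Khat k => -y := by
  refine Isometry.continuous (Isometry.of_dist_eq fun x y => ?_)
  rw [dist_eq_absInf, dist_eq_absInf, neg_sub_neg, absInf_sub_comm]

lemma exists_forall_digit_eq {f : Khat k} (hf : f ∈ XinvO k ∩ cK k) (n : ℕ) :
    ∃ δ > 0, ∀ g ∈ XinvO k ∩ cK k, absInf (g - f) < δ → digit n g = digit n f := by
  have hf0 := ne_zero_of_mem_cK hf.2
  have hpos := absInf_pos hf0
  induction n generalizing f with
  | zero =>
    refine ⟨min (absInf f) (1 * absInf f ^ 2), by positivity, fun g _ h => ?_⟩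
    exact intPart_eq_of_absInf_sub_lt (absInf_inv_sub_inv_lt hf0
      (h.trans_le (min_le_left _ _)) (h.trans_le (min_le_right _ _)))
  | succ n ih =>
    have hψ := ArtinPsi_mem hf
    obtain ⟨δ, hδ, H⟩ := ih hψ (ne_zero_of_mem_cK hψ.2) (absInf_pos (ne_zero_of_mem_cK hψ.2))
    refine ⟨min (absInf f) (min 1 δ * absInf f ^ 2), by positivity, fun g hg h => ?_⟩
    have hinv := absInf_inv_sub_inv_lt hf0 (h.trans_le (min_le_left _ _))
      (h.trans_le (min_le_right _ _))
    rw [digit_succ, digit_succ]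
    refine H _ (ArtinPsi_mem hg) ?_
    rw [ArtinPsi, ArtinPsi, fracPart, fracPart,
      intPart_eq_of_absInf_sub_lt (hinv.trans_le (min_le_left _ _)), sub_sub_sub_cancel_right]
    exact hinv.trans_le (min_le_right _ _)

lemma continuous_digit (n : ℕ) :
    Continuous fun f : ↥(XinvO k ∩ cK k) => digit n (f : Khat k) := by
  rw [Metric.continuous_iff]
  intro f ε hε
  obtain ⟨δ, hδ, H⟩ := exists_forall_digit_eq f.2 n
  refine ⟨δ, hδ, fun g hg => ?_⟩
  rw [H g g.2 hg, dist_self]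
  exact hε

lemma eq_of_mem_Aset_of_absInf_sub_lt {a b : Khat k} (ha : a ∈ Aset k) (hb : b ∈ Aset k)
    (h : absInf (a - b) < 1) : a = b :=
  sub_eq_zero.mp (eq_zero_of_mem_Aset_of_lt_one
    (sub_mem (S := Subalgebra k (Khat k)) (mem_Aset_iff.mp ha) (mem_Aset_iff.mp hb)) h)

instance : DiscreteTopology ↥(AmK k) :=
  DiscreteTopology.of_forall_le_dist one_pos fun a b hab => by
    by_contra! h
    exact hab (Subtype.ext (eq_of_mem_Aset_of_absInf_sub_lt a.2.1 b.2.1 h))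

lemma continuous_cfLimit :
    Continuous fun a : ℕ → ↥(AmK k) => cfLimit fun n => (a n : Khat k) := by
  rw [continuous_iff_continuousAt]
  intro a
  rw [Metric.continuousAt_iff']
  intro ε hε
  obtain ⟨n, hn⟩ := exists_pow_lt_of_lt_one hε (inv_lt_one_of_one_lt₀ (one_lt_card_real (k := k)))
  have hopen : ∀ᶠ b : ℕ → ↥(AmK k) in nhds a, ∀ i ∈ Finset.range n, b i = a i := by
    rw [Filter.eventually_all_finset]
    intro i _
    exact ((isOpen_discrete {a i}).preimage
      (continuous_apply (A := fun _ : ℕ => ↥(AmK k)) i)).mem_nhds rfl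
  filter_upwards [hopen] with b hb
  refine lt_of_le_of_lt ?_ hn
  rw [inv_pow, ← zpow_natCast, ← zpow_neg]
  refine absInf_sub_le_of_digit_eq (cfLimit_mem fun i => (b i).2) (cfLimit_mem fun i => (a i).2)
    fun i hi => ?_
  rw [digit_cfLimit fun i => (b i).2, digit_cfLimit fun i => (a i).2, hb i (Finset.mem_range.mpr hi)]

lemma neg_inv_mem_XinvO {f : Khat k} (hf : f ∈ Jset k ∩ cK k) : -f⁻¹ ∈ XinvO k ∩ cK k := by
  refine ⟨mem_XinvO.mpr ?_, neg_mem_cK (inv_mem_cK hf.2)⟩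
  rw [absInf_neg, absInf_inv]
  exact inv_lt_one_of_one_lt₀ (mem_Jset_iff.mp hf.1)

lemma neg_inv_mem_Jset {f : Khat k} (hf : f ∈ XinvO k ∩ cK k) : -f⁻¹ ∈ Jset k ∩ cK k := by
  refine ⟨mem_Jset_iff.mpr ?_, neg_mem_cK (inv_mem_cK hf.2)⟩
  rw [absInf_neg]
  exact one_lt_absInf_inv hf

lemma ThetaRaw_mem_AmK {p : Khat k × Khat k} (hp : p ∈ OmegaSet k) (n : ℤ) :
    ThetaRaw p n ∈ AmK k := by
  rw [ThetaRaw]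
  split_ifs
  · exact digit_mem_AmK hp.2 _
  · exact digit_mem_AmK (neg_inv_mem_XinvO hp.1) _

lemma continuous_OmegaSet_snd :
    Continuous fun ℓ : ↥(OmegaSet k) => (⟨(ℓ : Khat k × Khat k).2, ℓ.2.2⟩ : ↥(XinvO k ∩ cK k)) :=
  Continuous.subtype_mk (continuous_snd.comp continuous_subtype_val) _

lemma continuous_OmegaSet_neg_inv_fst :
    Continuous fun ℓ : ↥(OmegaSet k) =>
      (⟨-(ℓ : Khat k × Khat k).1⁻¹, neg_inv_mem_XinvO ℓ.2.1⟩ : ↥(XinvO k ∩ cK k)) := by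
  refine Continuous.subtype_mk ?_ _
  refine continuous_neg_Khat.comp (continuous_iff_continuousAt.mpr fun ℓ => ?_)
  exact ContinuousAt.comp (f := fun ℓ : ↥(OmegaSet k) => (ℓ : Khat k × Khat k).1)
    (continuousAt_inv_Khat (ne_zero_of_mem_cK ℓ.2.1.2))
    (continuous_fst.comp continuous_subtype_val).continuousAt

lemma continuous_ThetaRaw (n : ℤ) :
    Continuous fun ℓ : ↥(OmegaSet k) => ThetaRaw (ℓ : Khat k × Khat k) n := by
  by_cases hn : 1 ≤ n
  · simp only [ThetaRaw, if_pos hn]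
    have h := (continuous_digit (k := k) (n - 1).toNat).comp continuous_OmegaSet_snd
    exact h
  · simp only [ThetaRaw, if_neg hn]
    have h := (continuous_digit (k := k) (-n).toNat).comp continuous_OmegaSet_neg_inv_fst
    exact h

lemma continuous_neg_inv_cfLimit :
    Continuous fun a : ℕ → ↥(AmK k) => -(cfLimit fun n => (a n : Khat k))⁻¹ := by
  refine continuous_neg_Khat.comp (continuous_iff_continuousAt.mpr fun a => ?_)
  exact ContinuousAt.comp (f := fun a : ℕ → ↥(AmK k) => cfLimit fun n => (a n : Khat k))
    (continuousAt_inv_Khat (ne_zero_of_mem_cK (cfLimit_mem fun n => (a n).2).2))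
    continuous_cfLimit.continuousAt

/-- The coding map `Θ'` as a homeomorphism; its inverse evaluates the two continued fractions
encoded by a bilateral sequence. -/
def thetaHomeomorph : ↥(OmegaSet k) ≃ₜ (ℤ → ↥(AmK k)) where
  toFun ℓ n := ⟨ThetaRaw (ℓ : Khat k × Khat k) n, ThetaRaw_mem_AmK ℓ.2 n⟩
  invFun c := ⟨(-(cfLimit fun n : ℕ => (c (-n) : Khat k))⁻¹,
      cfLimit fun n : ℕ => (c (n + 1) : Khat k)),
    neg_inv_mem_Jset (cfLimit_mem fun n => (c (-n)).2), cfLimit_mem fun n => (c (n + 1)).2⟩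
  left_inv ℓ := by
    have h1 : ∀ n : ℕ, ThetaRaw (ℓ : Khat k × Khat k) (-n) =
        digit n (-(ℓ : Khat k × Khat k).1⁻¹) := fun n => by
      rw [ThetaRaw, if_neg (by lia), neg_neg, Int.toNat_natCast]
    have h2 : ∀ n : ℕ, ThetaRaw (ℓ : Khat k × Khat k) (n + 1) =
        digit n (ℓ : Khat k × Khat k).2 := fun n => by
      rw [ThetaRaw, if_pos (by lia), add_sub_cancel_right, Int.toNat_natCast]
    refine Subtype.ext (Prod.ext ?_ ?_)
    · simp only [h1]
      rw [cfLimit_digit (neg_inv_mem_XinvO ℓ.2.1), inv_neg, neg_neg, inv_inv]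
    · simp only [h2]
      exact cfLimit_digit ℓ.2.2
  right_inv c := by
    funext n
    refine Subtype.ext ?_
    by_cases hn : 1 ≤ n
    · simp only [ThetaRaw, if_pos hn]
      rw [digit_cfLimit fun n => (c (n + 1)).2]
      congr 2
      lia
    · simp only [ThetaRaw, if_neg hn]
      rw [inv_neg, neg_neg, inv_inv, digit_cfLimit fun n => (c (-n)).2]
      congr 2
      lia
  continuous_toFun := continuous_pi fun n => (continuous_ThetaRaw n).subtype_mk _
  continuous_invFun :=
    ((continuous_neg_inv_cfLimit.comp (continuous_pi fun n : ℕ => continuous_apply (-(n : ℤ)))).prodMk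
      (continuous_cfLimit.comp (continuous_pi fun n : ℕ => continuous_apply ((n : ℤ) + 1)))).subtype_mk _

lemma ThetaRaw_PhiRaw {p : Khat k × Khat k} (hp : p ∈ OmegaSet k) (n : ℤ) :
    ThetaRaw (PhiRaw p) n = ThetaRaw p (n + 1) := by
  have hneg : -(PhiRaw p).1⁻¹ = (digit 0 p.2 + -p.1⁻¹)⁻¹ := by
    rw [← inv_neg, PhiRaw, digit_zero, neg_sub, sub_eq_add_neg]
  have ha := (mem_AmK_iff.mp (digit_mem_AmK hp.2 0)).1
  have hx := mem_XinvO.mp (neg_inv_mem_XinvO hp.1).1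
  rcases lt_trichotomy n 0 with hn | rfl | hn
  · obtain ⟨m, rfl⟩ : ∃ m : ℕ, n = -(m + 1 : ℕ) := ⟨(-n - 1).toNat, by lia⟩
    rw [ThetaRaw, if_neg (by lia), ThetaRaw, if_neg (by lia), hneg, neg_neg, Int.toNat_natCast,
      digit_succ, ArtinPsi_inv_add ha hx]
    congr 1
    lia
  · rw [ThetaRaw, if_neg (by lia), ThetaRaw, if_pos (by lia), hneg]
    exact digit_zero_inv_add ha hx
  · obtain ⟨m, rfl⟩ : ∃ m : ℕ, n = m + 1 := ⟨(n - 1).toNat, by lia⟩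
    rw [ThetaRaw, if_pos (by lia), ThetaRaw, if_pos (by lia), add_sub_cancel_right,
      add_sub_cancel_right, Int.toNat_natCast, show ((m : ℤ) + 1).toNat = m + 1 by lia, digit_succ]
    rfl

end Helpers

/-- The coding map `Θ' : Ω → (A∖k)^ℤ` is a homeomorphism conjugating the
natural extension `Φ` of the Artin map with the left shift `σ`. -/
theorem statement_0 (k : Type*) [Field k] [Fintype k]
    (Φ : ↥(OmegaSet k) → ↥(OmegaSet k))
    (hΦ : ∀ ℓ : ↥(OmegaSet k), (Φ ℓ : Khat k × Khat k) = PhiRaw (ℓ : Khat k × Khat k)) :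
    ∃ Θ' : ↥(OmegaSet k) ≃ₜ (ℤ → ↥(AmK k)),
      (∀ (ℓ : ↥(OmegaSet k)) (n : ℤ),
          (Θ' ℓ n : Khat k) = ThetaRaw (ℓ : Khat k × Khat k) n) ∧
      (∀ (ℓ : ↥(OmegaSet k)) (n : ℤ), Θ' (Φ ℓ) n = Θ' ℓ (n + 1)) := by
  refine ⟨thetaHomeomorph, fun _ _ => rfl, fun ℓ n => Subtype.ext ?_⟩
  show ThetaRaw (Φ ℓ : Khat k × Khat k) n = ThetaRaw (ℓ : Khat k × Khat k) (n + 1)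
  rw [hΦ, ThetaRaw_PhiRaw ℓ.2]

end ArtinCoding
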